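/- For all a, b, c, d > 0 with c < a·d, the random variable X_{a,b,c,d} does not exist; that is, there is no probability measure μ on (0,∞) with ∫ x^s dμ(x) = (Γ(c)/(Γ(a)·Γ(b)))·Γ(a+s)·Γ(b−s)/Γ(c+d·s) for every s ∈ (−a, b). -/

import Mathlib

open MeasureTheory Real

/-- `μ` is a law of the random variable `X_{a,b,c,d}`: a probability measure on `(0,∞)`
whose fractional moments are `Γ(c)/(Γ(a)Γ(b)) · Γ(a+s)Γ(b−s)/Γ(c+d·s)` for `s ∈ (−a,b)`. -/
def IsXLaw (a b c d : ℝ) (μ : Measure ℝ) : Prop :=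
  IsProbabilityMeasure μ ∧ μ (Set.Ioi (0 : ℝ))ᶜ = 0 ∧
    ∀ s ∈ Set.Ioo (-a) b,
      ∫⁻ x, ENNReal.ofReal (x ^ s) ∂μ =
        ENNReal.ofReal (Real.Gamma c / (Real.Gamma a * Real.Gamma b) *
          (Real.Gamma (a + s) * Real.Gamma (b - s) / Real.Gamma (c + d * s)))

/-- The random variable `X_{a,b,c,d}` exists. -/
def XExists (a b c d : ℝ) : Prop :=
  ∃ μ : Measure ℝ, IsXLaw a b c d μ

theorem XExists_not_of_c_lt_ad (a b c d : ℝ) (ha : 0 < a) (hb : 0 < b) (hc : 0 < c)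
    (hd : 0 < d) (h : c < a * d) : ¬ XExists a b c d := by
  rintro ⟨μ, hμ, hpos, hmom⟩
  -- At `s = -c / d` the factor `1 / Γ(c + d * s)` vanishes, but a moment is positive.
  have hs : -(c / d) ∈ Set.Ioo (-a) b :=
    ⟨neg_lt_neg ((div_lt_iff₀ hd).2 h), (neg_lt_zero.2 (div_pos hc hd)).trans hb⟩
  have hzero : c + d * -(c / d) = 0 := by
    field_simp
    ring
  have hint := hmom _ hs
  rw [hzero, Real.Gamma_zero, div_zero, mul_zero, ENNReal.ofReal_zero,
    lintegral_eq_zero_iff (by fun_prop)] at hint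
  have hmem : ∀ᵐ x ∂μ, x ∈ Set.Ioi (0 : ℝ) := hpos
  have hfalse : ∀ᵐ _ ∂μ, False := by
    filter_upwards [hint, hmem] with x hx hx0
    exact (ENNReal.ofReal_pos.2 (Real.rpow_pos_of_pos hx0 _)).ne' hx
  exact hfalse.exists.elim fun _ hf => hf
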